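/- Let z = (z_Q, z_RD, z_RC) be a fluid solution with componentwise nonnegative initial state, and let T > 0. Then z is Lipschitz continuous on [0, T]: for all ν, t ∈ [0, T], ‖z(t) − z(ν)‖ ≤ C·|t − ν| with C = λ + μ·s + (θ + δ_RD + δ_RC)·(z_Q(0) + z_RD(0) + z_RC(0) + λ·T). (Deterministic analogue of the oscillation-control bound in the proof of Lemma 1.) -/

import Mathlib

/-- The fluid drift map of the call-center fluid model with redials and reconnects. -/
noncomputable def fluidDrift (lam s mu th p q dRD dRC : ℝ) :
    ℝ × ℝ × ℝ → ℝ × ℝ × ℝ :=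
  fun z =>
    (lam + dRD * z.2.1 + dRC * z.2.2 - mu * min s z.1 - th * max (z.1 - s) 0,
     p * th * max (z.1 - s) 0 - dRD * z.2.1,
     q * mu * min s z.1 - dRC * z.2.2)

/-- A fluid solution: a function continuous on `[0, ∞)` satisfying the integral equation
`z(t) = z(0) + ∫₀ᵗ H(z(u)) du` for all `t ≥ 0`. -/
def IsFluidSolution (lam s mu th p q dRD dRC : ℝ) (z : ℝ → ℝ × ℝ × ℝ) : Prop :=
  ContinuousOn z (Set.Ici 0) ∧
    ∀ t : ℝ, 0 ≤ t →
      z t = z 0 + ∫ u in (0:ℝ)..t, fluidDrift lam s mu th p q dRD dRC (z u)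

lemma hasDerivAt_min_zero_sq (x : ℝ) :
    HasDerivAt (fun y : ℝ => min y 0 ^ 2) (2 * min x 0) x := by
  have hne : ∀ y : ℝ, y ≠ 0 → HasDerivAt (fun y : ℝ => min y 0 ^ 2) (2 * min y 0) y := by
    intro y hy
    rcases lt_or_gt_of_ne hy with h | h
    · rw [min_eq_left h.le]
      have h1 : HasDerivAt (fun y : ℝ => y ^ 2) (2 * y) y := by
        simpa using hasDerivAt_pow 2 y
      refine h1.congr_of_eventuallyEq ?_
      filter_upwards [Iio_mem_nhds h] with w hw
      rw [min_eq_left (le_of_lt hw)]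
    · rw [min_eq_right h.le, mul_zero]
      refine (hasDerivAt_const y (0 : ℝ)).congr_of_eventuallyEq ?_
      filter_upwards [Ioi_mem_nhds h] with w hw
      rw [min_eq_right (le_of_lt hw)]
      norm_num
  by_cases hx : x = 0
  · subst hx
    exact hasDerivAt_of_hasDerivAt_of_ne hne (by fun_prop) (by fun_prop)
  · exact hne x hx

lemma continuous_fluidDrift (lam s mu th p q dRD dRC : ℝ) :
    Continuous (fluidDrift lam s mu th p q dRD dRC) := by
  unfold fluidDrift
  fun_prop

/-- A fluid solution agrees on `[0, ∞)` with a function that solves the fluid differential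
equation there in the sense of two-sided derivatives. -/
lemma IsFluidSolution.exists_hasDerivAt {lam s mu th p q dRD dRC : ℝ} {z : ℝ → ℝ × ℝ × ℝ}
    (hz : IsFluidSolution lam s mu th p q dRD dRC z) :
    ∃ F : ℝ → ℝ × ℝ × ℝ, (∀ t, 0 ≤ t → F t = z t) ∧
      ∀ t, 0 ≤ t → HasDerivAt F (fluidDrift lam s mu th p q dRD dRC (F t)) t := by
  obtain ⟨hc, hi⟩ := hz
  have hy : Continuous (fun t : ℝ => z (max t 0)) :=
    hc.comp_continuous (by fun_prop) (fun t => le_max_right t 0)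
  have hH : Continuous (fun t : ℝ => fluidDrift lam s mu th p q dRD dRC (z (max t 0))) :=
    (continuous_fluidDrift lam s mu th p q dRD dRC).comp hy
  have hF : ∀ t, 0 ≤ t →
      z 0 + ∫ u in (0:ℝ)..t, fluidDrift lam s mu th p q dRD dRC (z (max u 0)) = z t := by
    intro t ht
    rw [hi t ht]
    congr 1
    refine intervalIntegral.integral_congr fun u hu => ?_
    rw [Set.uIcc_of_le ht] at hu
    simp only [max_eq_left hu.1]
  refine ⟨_, hF, fun t ht => ?_⟩
  have h := (hH.integral_hasStrictDerivAt 0 t).hasDerivAt.const_add (z 0)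
  rw [hF t ht]
  simpa only [max_eq_left ht] using h

/-- Solutions of the fluid differential equation stay in the nonnegative orthant. -/
lemma fluidDrift_solution_nonneg {lam s mu th p q dRD dRC : ℝ}
    (hlam : 0 ≤ lam) (hs : 0 < s) (hmu : 0 < mu) (hth : 0 < th) (hp0 : 0 ≤ p)
    (hq0 : 0 ≤ q) (hq1 : q < 1) (hdRD : 0 < dRD) (hdRC : 0 < dRC) {F : ℝ → ℝ × ℝ × ℝ}
    (hF : ∀ t, 0 ≤ t → HasDerivAt F (fluidDrift lam s mu th p q dRD dRC (F t)) t)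
    (hQ0 : 0 ≤ (F 0).1) (hRD0 : 0 ≤ (F 0).2.1) (hRC0 : 0 ≤ (F 0).2.2) {t : ℝ} (ht : 0 ≤ t) :
    0 ≤ (F t).1 ∧ 0 ≤ (F t).2.1 ∧ 0 ≤ (F t).2.2 := by
  let K := dRD + dRC + mu
  let W : ℝ → ℝ := fun t => min (F t).1 0 ^ 2 + min (F t).2.1 0 ^ 2 + min (F t).2.2 0 ^ 2
  let W' : ℝ → ℝ := fun t =>
    2 * min (F t).1 0 * (fluidDrift lam s mu th p q dRD dRC (F t)).1
      + 2 * min (F t).2.1 0 * (fluidDrift lam s mu th p q dRD dRC (F t)).2.1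
      + 2 * min (F t).2.2 0 * (fluidDrift lam s mu th p q dRD dRC (F t)).2.2
  have hW : ∀ t, 0 ≤ t → HasDerivAt W (W' t) t := by
    intro t ht
    have h := hF t ht
    exact (((hasDerivAt_min_zero_sq _).comp t h.fst).add
      ((hasDerivAt_min_zero_sq _).comp t h.snd.fst)).add
      ((hasDerivAt_min_zero_sq _).comp t h.snd.snd)
  have hle : ∀ t, W' t ≤ K * W t := by
    intro t
    simp only [W', W, K, fluidDrift]
    generalize (F t).1 = x
    generalize (F t).2.1 = y
    generalize (F t).2.2 = w
    have ha : min x 0 ≤ 0 := min_le_right _ _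
    have hb : min y 0 ≤ 0 := min_le_right _ _
    have hc : min w 0 ≤ 0 := min_le_right _ _
    have hy : min y 0 ≤ y := min_le_left _ _
    have hw : min w 0 ≤ w := min_le_left _ _
    have hyy : min y 0 * y = min y 0 ^ 2 := by
      rcases le_total y 0 with h | h <;> simp [h, sq]
    have hww : min w 0 * w = min w 0 ^ 2 := by
      rcases le_total w 0 with h | h <;> simp [h, sq]
    have hxs : min x 0 * min s x = min x 0 ^ 2 := by
      rcases le_total x 0 with h | h
      · simp [h, sq, h.trans hs.le]
      · simp [h]
    have hxm : min x 0 * max (x - s) 0 = 0 := by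
      rcases le_total x 0 with h | h
      · rw [max_eq_right (by linarith), mul_zero]
      · simp [h]
    have hsx : min x 0 ≤ min s x := le_min (ha.trans hs.le) (min_le_left _ _)
    have hm : 0 ≤ max (x - s) 0 := le_max_right _ _
    generalize min x 0 = a at *
    generalize min y 0 = b at *
    generalize min w 0 = c at *
    generalize min s x = m at *
    generalize max (x - s) 0 = n at *
    have h1 : a * lam ≤ 0 := mul_nonpos_of_nonpos_of_nonneg ha hlam
    have h2 : dRD * (a * y) ≤ dRD * (a * b) :=
      mul_le_mul_of_nonneg_left (mul_le_mul_of_nonpos_left hy ha) hdRD.le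
    have h3 : dRC * (a * w) ≤ dRC * (a * c) :=
      mul_le_mul_of_nonneg_left (mul_le_mul_of_nonpos_left hw ha) hdRC.le
    have h4 : b * (p * th * n) ≤ 0 := mul_nonpos_of_nonpos_of_nonneg hb (by positivity)
    have h5 : q * mu * (c * m) ≤ q * mu * (c * a) :=
      mul_le_mul_of_nonneg_left (mul_le_mul_of_nonpos_left hsx hc) (by positivity)
    have h6 : q * mu * (c * a) ≤ mu * (c * a) := by
      have : 0 ≤ c * a := mul_nonneg_of_nonpos_of_nonpos hc ha
      have := mul_nonneg (mul_nonneg (sub_nonneg.2 hq1.le) hmu.le) this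
      linarith
    have h7 : 0 ≤ dRD * (a - b) ^ 2 := by positivity
    have h8 : 0 ≤ dRC * (a - c) ^ 2 := by positivity
    have h9 : 0 ≤ mu * (a - c) ^ 2 := by positivity
    have e1 : 0 ≤ mu * a ^ 2 := by positivity
    have e2 : 0 ≤ dRD * b ^ 2 := by positivity
    have e3 : 0 ≤ dRC * c ^ 2 := by positivity
    have e4 : 0 ≤ dRD * c ^ 2 := by positivity
    have e5 : 0 ≤ dRC * b ^ 2 := by positivity
    have e6 : 0 ≤ mu * b ^ 2 := by positivity
    calc 2 * a * (lam + dRD * y + dRC * w - mu * m - th * n) + 2 * b * (p * th * n - dRD * y)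
          + 2 * c * (q * mu * m - dRC * w)
        = 2 * (a * lam) + 2 * (dRD * (a * y)) + 2 * (dRC * (a * w)) - 2 * mu * (a * m)
          - 2 * th * (a * n) + 2 * (b * (p * th * n)) - 2 * dRD * (b * y)
          + 2 * (q * mu * (c * m)) - 2 * dRC * (c * w) := by ring
      _ ≤ (dRD + dRC + mu) * (a ^ 2 + b ^ 2 + c ^ 2) := by
        rw [hyy, hww, hxs, hxm]
        linarith
  have hG : ∀ t, 0 ≤ t → HasDerivAt (fun t => Real.exp (-K * t) * W t)
      (Real.exp (-K * t) * (W' t - K * W t)) t := by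
    intro t ht
    have h1 : HasDerivAt (fun t => Real.exp (-K * t)) (Real.exp (-K * t) * -K) t := by
      simpa using ((hasDerivAt_id t).const_mul (-K)).exp
    refine (h1.mul (hW t ht)).congr_deriv ?_
    ring
  have hanti : AntitoneOn (fun t => Real.exp (-K * t) * W t) (Set.Ici 0) := by
    refine antitoneOn_of_hasDerivWithinAt_nonpos (convex_Ici 0)
      (fun t ht => (hG t ht).continuousAt.continuousWithinAt)
      (fun t ht => (hG t (interior_subset ht)).hasDerivWithinAt) fun t _ => ?_
    exact mul_nonpos_of_nonneg_of_nonpos (Real.exp_pos _).le (sub_nonpos.2 (hle t))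
  have h0 : W 0 = 0 := by simp [W, hQ0, hRD0, hRC0]
  have h1 : Real.exp (-K * t) * W t ≤ 0 := by
    have := hanti (Set.self_mem_Ici) ht ht
    simpa [h0] using this
  have h2 : W t ≤ 0 := nonpos_of_mul_nonpos_right h1 (Real.exp_pos _)
  have key : ∀ x : ℝ, min x 0 ^ 2 ≤ 0 → 0 ≤ x := fun x hx => by
    have : min x 0 = 0 := pow_eq_zero_iff two_ne_zero |>.1 (le_antisymm hx (sq_nonneg _))
    exact min_eq_right_iff.1 this
  have a1 := sq_nonneg (min (F t).1 0)
  have a2 := sq_nonneg (min (F t).2.1 0)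
  have a3 := sq_nonneg (min (F t).2.2 0)
  simp only [W] at h2
  exact ⟨key _ (by linarith), key _ (by linarith), key _ (by linarith)⟩

/-- The total content of a nonnegative fluid solution grows at most at the arrival rate. -/
lemma fluidDrift_solution_total_le {lam s mu th p q dRD dRC : ℝ}
    (hs : 0 < s) (hmu : 0 < mu) (hth : 0 < th) (hp1 : p ≤ 1) (hq1 : q < 1)
    {F : ℝ → ℝ × ℝ × ℝ}
    (hF : ∀ t, 0 ≤ t → HasDerivAt F (fluidDrift lam s mu th p q dRD dRC (F t)) t)
    (hQ : ∀ t, 0 ≤ t → 0 ≤ (F t).1) {t : ℝ} (ht : 0 ≤ t) :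
    (F t).1 + (F t).2.1 + (F t).2.2 ≤ (F 0).1 + (F 0).2.1 + (F 0).2.2 + lam * t := by
  have hS : ∀ t, 0 ≤ t → HasDerivAt (fun t => (F t).1 + (F t).2.1 + (F t).2.2 - lam * t)
      (-((1 - p) * th * max ((F t).1 - s) 0 + (1 - q) * mu * min s (F t).1)) t := by
    intro t ht
    have h := hF t ht
    have hl : HasDerivAt (fun t => lam * t) lam t := by
      simpa using (hasDerivAt_id t).const_mul lam
    have h1 : HasDerivAt (fun t => (F t).1) (fluidDrift lam s mu th p q dRD dRC (F t)).1 t := h.fst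
    have h2 : HasDerivAt (fun t => (F t).2.1) (fluidDrift lam s mu th p q dRD dRC (F t)).2.1 t := h.snd.fst
    have h3 : HasDerivAt (fun t => (F t).2.2) (fluidDrift lam s mu th p q dRD dRC (F t)).2.2 t := h.snd.snd
    refine (((h1.add h2).add h3).sub hl).congr_deriv ?_
    simp only [fluidDrift]
    ring
  have hanti : AntitoneOn (fun t => (F t).1 + (F t).2.1 + (F t).2.2 - lam * t) (Set.Ici 0) := by
    refine antitoneOn_of_hasDerivWithinAt_nonpos (convex_Ici 0)
      (fun t ht => (hS t ht).continuousAt.continuousWithinAt)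
      (fun t ht => (hS t (interior_subset ht)).hasDerivWithinAt) fun t ht => ?_
    have h1 : 0 ≤ min s (F t).1 := le_min hs.le (hQ t (interior_subset ht))
    have h2 : 0 ≤ max ((F t).1 - s) 0 := le_max_right _ _
    have h3 : 0 ≤ 1 - p := sub_nonneg.2 hp1
    have h4 : 0 ≤ 1 - q := sub_nonneg.2 hq1.le
    exact neg_nonpos.2 (by positivity)
  have := hanti Set.self_mem_Ici ht ht
  simp only [mul_zero] at this
  linarith

lemma norm_fluidDrift_le {lam s mu th p q dRD dRC M : ℝ}
    (hlam : 0 ≤ lam) (hs : 0 < s) (hmu : 0 < mu) (hth : 0 < th)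
    (hp0 : 0 ≤ p) (hp1 : p ≤ 1) (hq0 : 0 ≤ q) (hq1 : q < 1)
    (hdRD : 0 < dRD) (hdRC : 0 < dRC) {x : ℝ × ℝ × ℝ}
    (hx : 0 ≤ x.1 ∧ 0 ≤ x.2.1 ∧ 0 ≤ x.2.2) (hM : x.1 + x.2.1 + x.2.2 ≤ M) :
    ‖fluidDrift lam s mu th p q dRD dRC x‖ ≤ lam + mu * s + (th + dRD + dRC) * M := by
  obtain ⟨x, y, w⟩ := x
  obtain ⟨hx, hy, hw⟩ := hx
  simp only at hx hy hw hM
  have hM0 : 0 ≤ M := by linarith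
  have b1 : 0 ≤ mu * min s x := mul_nonneg hmu.le (le_min hs.le hx)
  have b2 : mu * min s x ≤ mu * s := mul_le_mul_of_nonneg_left (min_le_left _ _) hmu.le
  have b3 : 0 ≤ th * max (x - s) 0 := mul_nonneg hth.le (le_max_right _ _)
  have b4 : th * max (x - s) 0 ≤ th * M :=
    mul_le_mul_of_nonneg_left (max_le (by linarith) hM0) hth.le
  have b5 : dRD * y ≤ dRD * M := mul_le_mul_of_nonneg_left (by linarith) hdRD.le
  have b6 : dRC * w ≤ dRC * M := mul_le_mul_of_nonneg_left (by linarith) hdRC.le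
  have b7 : 0 ≤ dRD * y := by positivity
  have b8 : 0 ≤ dRC * w := by positivity
  have b9 : p * (th * max (x - s) 0) ≤ th * max (x - s) 0 := mul_le_of_le_one_left b3 hp1
  have c1 : 0 ≤ p * (th * max (x - s) 0) := mul_nonneg hp0 b3
  have c2 : q * (mu * min s x) ≤ mu * min s x := mul_le_of_le_one_left b1 hq1.le
  have c3 : 0 ≤ q * (mu * min s x) := mul_nonneg hq0 b1
  simp only [fluidDrift, Prod.norm_mk, Real.norm_eq_abs, max_le_iff, abs_le, mul_assoc, add_mul]
  refine ⟨⟨?_, ?_⟩, ⟨?_, ?_⟩, ?_, ?_⟩ <;> linarith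

/-- a fluid solution with nonnegative initial state is Lipschitz on `[0, T]`
with the explicit constant `C = λ + μs + (θ + δ_RD + δ_RC)(z_Q(0)+z_RD(0)+z_RC(0) + λT)`. -/
theorem fluid_solution_lipschitz_on_interval (lam s mu th p q dRD dRC : ℝ)
    (hlam : 0 ≤ lam) (hs : 0 < s) (hmu : 0 < mu) (hth : 0 < th)
    (hp0 : 0 ≤ p) (hp1 : p ≤ 1) (hq0 : 0 ≤ q) (hq1 : q < 1)
    (hdRD : 0 < dRD) (hdRC : 0 < dRC) (z : ℝ → ℝ × ℝ × ℝ)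
    (hz : IsFluidSolution lam s mu th p q dRD dRC z)
    (hQ0 : 0 ≤ (z 0).1) (hRD0 : 0 ≤ (z 0).2.1) (hRC0 : 0 ≤ (z 0).2.2)
    (T : ℝ) (hT : 0 < T) :
    ∀ ν ∈ Set.Icc (0:ℝ) T, ∀ t ∈ Set.Icc (0:ℝ) T,
      ‖z t - z ν‖ ≤
        (lam + mu * s +
          (th + dRD + dRC) * ((z 0).1 + (z 0).2.1 + (z 0).2.2 + lam * T)) * |t - ν| := by
  obtain ⟨F, hFz, hF⟩ := hz.exists_hasDerivAt
  rw [← hFz 0 le_rfl] at hQ0 hRD0 hRC0 ⊢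
  have hpos : ∀ t, 0 ≤ t → 0 ≤ (F t).1 ∧ 0 ≤ (F t).2.1 ∧ 0 ≤ (F t).2.2 := fun t ht =>
    fluidDrift_solution_nonneg hlam hs hmu hth hp0 hq0 hq1 hdRD hdRC hF hQ0 hRD0 hRC0 ht
  intro ν hν t ht
  rw [← hFz ν hν.1, ← hFz t ht.1, ← Real.norm_eq_abs]
  refine (convex_Icc (0:ℝ) T).norm_image_sub_le_of_norm_hasDerivWithin_le
    (fun u hu => (hF u hu.1).hasDerivWithinAt) (fun u hu => ?_) hν ht
  refine norm_fluidDrift_le hlam hs hmu hth hp0 hp1 hq0 hq1 hdRD hdRC (hpos u hu.1) ?_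
  have h1 := fluidDrift_solution_total_le hs hmu hth hp1 hq1 hF (fun t ht => (hpos t ht).1) hu.1
  have h2 : lam * u ≤ lam * T := mul_le_mul_of_nonneg_left hu.2 hlam
  linarith
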